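/- Let p and q be distinct primes and let n be the multiplicative order of p modulo q. Then there is no simple left brace of cardinality p^n·q; that is, no group structure and abelian group structure making a set of cardinality p^n·q into a left brace can have {0} and the whole brace as its only ideals. -/

import Mathlib

/-- A left brace: a set with an abelian group structure `(B,+)` and a group structure
`(B,·)` satisfying `a·(b+c)+a = a·b+a·c`. -/
class LeftBrace (B : Type*) extends AddCommGroup B, Group B where
  left_compat : ∀ a b c : B, a * (b + c) + a = a * b + a * c

/-- `B` is a simple left brace: it has more than one element and its only ideals
(normal subgroups of `(B,·)` invariant under all `λ_b(a) = b·a − b`) are `{0}` and `B`. -/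
def IsSimpleBrace (B : Type*) [LeftBrace B] : Prop :=
  Nontrivial B ∧ ∀ I : Subgroup B, I.Normal →
    (∀ a ∈ I, ∀ b : B, b * a - b ∈ I) → ((I : Set B) = {(0 : B)} ∨ I = ⊤)

namespace LeftBrace

variable {B : Type*} [LeftBrace B]

lemma mul_zero_eq (a : B) : a * (0 : B) = a := by
  have h := left_compat a 0 0
  rw [add_zero] at h
  exact (add_left_cancel h).symm

lemma one_eq_zero : (1 : B) = 0 := by
  rw [← mul_zero_eq (1 : B), one_mul]

/-- The automorphism `λ_a : b ↦ a * b - a` of the additive group of a left brace. -/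
def lambda (a : B) : B ≃+ B where
  toFun b := a * b - a
  invFun c := a⁻¹ * (c + a)
  left_inv b := by simp
  right_inv c := by simp
  map_add' b c := by
    have h := left_compat a b c
    rw [eq_sub_of_add_eq h]
    abel

lemma mul_eq_add_lambda (a b : B) : a * b = a + lambda a b :=
  (add_sub_cancel a (a * b)).symm

/-- A finite additive subgroup of a left brace which is invariant under all `λ_b` is a
multiplicative subgroup. -/
def subgroupOfInvariant [Finite B] (T : AddSubgroup B)
    (hT : ∀ b : B, ∀ a ∈ T, lambda b a ∈ T) : Subgroup B where
  carrier := T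
  mul_mem' {a b} ha hb := by
    rw [mul_eq_add_lambda]
    exact T.add_mem ha (hT a b hb)
  one_mem' := by
    rw [one_eq_zero]
    exact T.zero_mem
  inv_mem' {a} ha := by
    have h : lambda a⁻¹ a = -a⁻¹ := by
      change a⁻¹ * a - a⁻¹ = -a⁻¹
      rw [inv_mul_cancel, one_eq_zero, zero_sub]
    have h' := T.neg_mem (hT a⁻¹ a ha)
    rwa [h, neg_neg] at h'

/-- A normal Sylow subgroup of the multiplicative group of a finite left brace is an ideal. -/
theorem lambda_mem_of_normal_sylow [Finite B] {p : ℕ} [Fact p.Prime] (S : Sylow p B)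
    (hS : (S : Subgroup B).Normal) {a : B} (ha : a ∈ (S : Subgroup B)) (b : B) :
    b * a - b ∈ (S : Subgroup B) := by
  obtain ⟨T⟩ : Nonempty (Sylow p (Multiplicative B)) := inferInstance
  have hchar : (T : Subgroup (Multiplicative B)).Characteristic :=
    T.characteristic_of_normal inferInstance
  have hT : ∀ b : B, ∀ a ∈ Subgroup.toAddSubgroup' (T : Subgroup (Multiplicative B)),
      lambda b a ∈ Subgroup.toAddSubgroup' (T : Subgroup (Multiplicative B)) := fun b a ha =>
    Subgroup.characteristic_iff_le_comap.mp hchar (AddEquiv.toMultiplicative (lambda b)) ha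
  have hcard : Nat.card (subgroupOfInvariant _ hT) = p ^ (Nat.card B).factorization p :=
    T.card_eq_multiplicity
  have := Sylow.unique_of_normal S hS
  have hST : S = Sylow.ofCard (subgroupOfInvariant _ hT) hcard := Subsingleton.elim _ _
  rw [hST] at ha ⊢
  exact hT b a ha

end LeftBrace

/-- If `n` is the multiplicative order of `p` modulo `q`, a group of order `p ^ n * q` has a
normal Sylow subgroup, for `p` or for `q`. -/
theorem exists_normal_sylow_of_card_pow_mul_prime {G : Type*} [Group G] [Finite G] {p q n : ℕ}
    [hp : Fact p.Prime] [hq : Fact q.Prime] (hpq : p ≠ q)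
    (hmin : ∀ m : ℕ, 0 < m → p ^ m ≡ 1 [MOD q] → n ≤ m)
    (hG : Nat.card G = p ^ n * q) :
    (∃ S : Sylow p G, (S : Subgroup G).Normal) ∨ ∃ S : Sylow q G, (S : Subgroup G).Normal := by
  have hfq : (Nat.card G).factorization q = 1 := by
    rw [hG, Nat.factorization_mul (pow_ne_zero _ hp.out.ne_zero) hq.out.ne_zero]
    simp [hp.out.factorization, hq.out.factorization, hpq]
  have hfp : (Nat.card G).factorization p = n := by
    rw [hG, Nat.factorization_mul (pow_ne_zero _ hp.out.ne_zero) hq.out.ne_zero]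
    simp [hp.out.factorization, hq.out.factorization, hpq.symm]
  obtain ⟨Q⟩ : Nonempty (Sylow q G) := inferInstance
  have hQ : Nat.card Q = q := by rw [Q.card_eq_multiplicity, hfq, pow_one]
  have hQi : (Q : Subgroup G).index = p ^ n := by
    have h := (Q : Subgroup G).card_mul_index
    rw [hG, mul_comm] at h
    exact Nat.eq_of_mul_eq_mul_right hq.out.pos (by rw [← h]; congr 1; exact hQ.symm)
  obtain ⟨m, hmn, hm⟩ := (Nat.dvd_prime_pow hp.out).mp (hQi ▸ Q.card_dvd_index)
  have hmod := card_sylow_modEq_one q G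
  rw [hm] at hmod
  have hidx := Q.card_eq_index_normalizer
  rw [hm] at hidx
  rcases Nat.eq_zero_or_pos m with rfl | hm0
  · right
    rw [pow_zero, eq_comm, Subgroup.index_eq_one] at hidx
    exact ⟨Q, Subgroup.normalizer_eq_top_iff.mp hidx⟩
  · left
    obtain rfl := le_antisymm hmn (hmin m hm0 hmod)
    have hN : Subgroup.normalizer (Q : Set G) = Q := by
      refine (Subgroup.eq_of_le_of_card_ge Subgroup.le_normalizer ?_).symm
      have h := (Subgroup.normalizer (Q : Set G)).card_mul_index
      rw [← hidx, hG, mul_comm] at h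
      exact (Nat.eq_of_mul_eq_mul_left (pow_pos hp.out.pos _) h).trans hQ.symm |>.le
    have : IsCyclic Q := isCyclic_of_prime_card hQ
    have hNC : Subgroup.normalizer (Q : Set G) ≤ Subgroup.centralizer (Q : Set G) := by
      rw [hN]
      exact Subgroup.le_centralizer (Q : Subgroup G)
    have hKcard : Nat.card (MonoidHom.transferSylow Q hNC).ker =
        p ^ (Nat.card G).factorization p := by
      rw [hfp, ← hQi]
      exact (MonoidHom.ker_transferSylow_isComplement' Q hNC).index_eq_card.symm
    exact ⟨Sylow.ofCard _ hKcard, MonoidHom.normal_ker _⟩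

/-- If the order of a finite simple left brace is divisible by a prime `p` and by another prime,
the multiplicative group has no normal Sylow `p`-subgroup. -/
theorem IsSimpleBrace.not_normal_sylow {B : Type*} [LeftBrace B] [Finite B]
    (hB : IsSimpleBrace B) {p r : ℕ} [hp : Fact p.Prime] [hr : Fact r.Prime] (hpr : p ≠ r)
    (hpB : p ∣ Nat.card B) (hrB : r ∣ Nat.card B) (S : Sylow p B) :
    ¬ (S : Subgroup B).Normal := by
  intro hS
  rcases hB.2 S hS fun a ha b => LeftBrace.lambda_mem_of_normal_sylow S hS ha b with h | h
  · refine S.ne_bot_of_dvd_card hpB ?_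
    rw [← SetLike.coe_set_eq, Subgroup.coe_bot, LeftBrace.one_eq_zero]
    exact h
  · obtain ⟨k, hk⟩ := IsPGroup.iff_card.mp S.isPGroup'
    rw [← Subgroup.card_top (G := B), ← h] at hrB
    exact hpr ((Nat.prime_dvd_prime_iff_eq hr.out hp.out).mp
      (hr.out.dvd_of_dvd_pow (hk ▸ hrB))).symm

/-- Let `p` and `q` be distinct primes and let `n` be the multiplicative order of `p`
modulo `q`. Then there is no simple left brace of cardinality `p^n·q`. -/
theorem no_simple_brace_of_card_pow_mul_prime (p q : ℕ) (hp : p.Prime) (hq : q.Prime)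
    (hpq : p ≠ q) (n : ℕ) (hn : 0 < n) (horder : p ^ n ≡ 1 [MOD q])
    (hmin : ∀ m : ℕ, 0 < m → p ^ m ≡ 1 [MOD q] → n ≤ m)
    (B : Type*) [LeftBrace B] [Fintype B] (hB : Fintype.card B = p ^ n * q) :
    ¬ IsSimpleBrace B := by
  have : Fact p.Prime := ⟨hp⟩
  have : Fact q.Prime := ⟨hq⟩
  intro h
  rw [← Nat.card_eq_fintype_card] at hB
  have hpB : p ∣ Nat.card B := hB ▸ (dvd_pow_self p hn.ne').mul_right q
  have hqB : q ∣ Nat.card B := hB ▸ dvd_mul_left q (p ^ n)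
  rcases exists_normal_sylow_of_card_pow_mul_prime hpq hmin hB with ⟨S, hS⟩ | ⟨S, hS⟩
  · exact h.not_normal_sylow hpq hpB hqB S hS
  · exact h.not_normal_sylow hpq.symm hqB hpB S hS
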